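/- Fix r > 0, ε ∈ (0,1). For each k ≥ 1 and n ≥ 1, let N_1 given K = k, N = n have the BetaBinomial(n, r, (k-1)r) distribution. Then there exists a sequence c_1, c_2, ... ≥ 0, not depending on n, with c_k → 0 as k → ∞, such that k · P(N_1/n ≥ ε | K = k, N = n) ≤ c_k for all n ≥ 2/ε and all k ≥ 1. -/

import Mathlib

open Real Filter Finset

/-- pmf of the beta-binomial distribution BetaBin(n,α,β), with
    `B(α,β) = Γ(α)Γ(β)/Γ(α+β)`. -/
noncomputable def betaBinPmf (n : ℕ) (α β : ℝ) (x : ℕ) : ℝ :=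
  (n.choose x : ℝ) *
    (Real.Gamma (x + α) * Real.Gamma ((n : ℝ) - x + β) / Real.Gamma ((n : ℝ) + α + β)) /
    (Real.Gamma α * Real.Gamma β / Real.Gamma (α + β))

theorem bb_antidiag (n : ℕ) : ∀ α β : ℝ, 0 < α → 0 < β →
    ∑ ij ∈ antidiagonal n, (n.choose ij.1 : ℝ) * (Real.Gamma (ij.1 + α) * Real.Gamma (ij.2 + β))
      = Real.Gamma (n + α + β) * (Real.Gamma α * Real.Gamma β / Real.Gamma (α + β)) := by
  induction n with
  | zero =>
    intro α β hα hβ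
    have h : Real.Gamma (α + β) ≠ 0 := (Real.Gamma_pos_of_pos (by positivity)).ne'
    simp
    field_simp
  | succ n ih =>
    intro α β hα hβ
    have key := Finset.sum_antidiagonal_choose_succ_mul
      (fun i j : ℕ => Real.Gamma ((i : ℝ) + α) * Real.Gamma ((j : ℝ) + β)) n
    rw [key]
    have h1 := ih (α + 1) β (by positivity) hβ
    have h2 := ih α (β + 1) hα (by positivity)
    have e2 : ∑ ij ∈ antidiagonal n, (n.choose ij.2 : ℝ) *
        (Real.Gamma (((ij.1 + 1 : ℕ) : ℝ) + α) * Real.Gamma ((ij.2 : ℝ) + β)) =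
        ∑ ij ∈ antidiagonal n, (n.choose ij.1 : ℝ) *
        (Real.Gamma (ij.1 + (α + 1)) * Real.Gamma (ij.2 + β)) := by
      refine Finset.sum_congr rfl fun ij hij => ?_
      rw [HasAntidiagonal.mem_antidiagonal] at hij
      rw [← Nat.choose_symm_of_eq_add hij.symm]
      push_cast
      congr 3
      ring
    have e1 : ∑ ij ∈ antidiagonal n, (n.choose ij.1 : ℝ) *
        (Real.Gamma ((ij.1 : ℝ) + α) * Real.Gamma (((ij.2 + 1 : ℕ) : ℝ) + β)) =
        ∑ ij ∈ antidiagonal n, (n.choose ij.1 : ℝ) *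
        (Real.Gamma (ij.1 + α) * Real.Gamma (ij.2 + (β + 1))) := by
      refine Finset.sum_congr rfl fun ij hij => ?_
      push_cast
      congr 3
      ring
    rw [e1, e2, h1, h2]
    have a1 : (n : ℝ) + α + (β + 1) = n + 1 + α + β := by ring
    have a2 : (n : ℝ) + (α + 1) + β = n + 1 + α + β := by ring
    have a3 : α + (β + 1) = α + β + 1 := by ring
    have a4 : α + 1 + β = α + β + 1 := by ring
    push_cast
    rw [a1, a2, a3, a4, Real.Gamma_add_one hα.ne', Real.Gamma_add_one hβ.ne',
      Real.Gamma_add_one (by positivity : α + β ≠ 0)]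
    have h : Real.Gamma (α + β) ≠ 0 := (Real.Gamma_pos_of_pos (by positivity)).ne'
    have h' : α + β ≠ 0 := by positivity
    field_simp
    ring

theorem bb_sum (n : ℕ) (α β : ℝ) (hα : 0 < α) (hβ : 0 < β) :
    ∑ x ∈ range (n + 1), (n.choose x : ℝ) * (Real.Gamma (x + α) * Real.Gamma ((n : ℝ) - x + β))
      = Real.Gamma (n + α + β) * (Real.Gamma α * Real.Gamma β / Real.Gamma (α + β)) := by
  rw [← bb_antidiag n α β hα hβ, Finset.Nat.sum_antidiagonal_eq_sum_range_succ_mk]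
  refine Finset.sum_congr rfl fun x hx => ?_
  have : x ≤ n := by simpa [Nat.lt_succ_iff] using hx
  simp [Nat.cast_sub this]

theorem choose_two (m y : ℕ) : (((m + 2).choose (y + 2) : ℕ) : ℝ) * (((y : ℝ) + 2) * (y + 1))
    = ((m : ℝ) + 2) * (m + 1) * (m.choose y : ℝ) := by
  have h1 := Nat.add_one_mul_choose_eq (m + 1) (y + 1)
  have h2 := Nat.add_one_mul_choose_eq m y
  have h1' : ((m : ℝ) + 1 + 1) * ((m + 1).choose (y + 1) : ℝ)
      = ((m + 2).choose (y + 2) : ℝ) * ((y : ℝ) + 1 + 1) := by exact_mod_cast h1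
  have h2' : ((m : ℝ) + 1) * (m.choose y : ℝ)
      = ((m + 1).choose (y + 1) : ℝ) * ((y : ℝ) + 1) := by exact_mod_cast h2
  linear_combination (-(y : ℝ) - 1) * h1' - ((m : ℝ) + 2) * h2'

theorem bb_moment (m : ℕ) (α β : ℝ) (hα : 0 < α) (hβ : 0 < β) :
    ∑ x ∈ range (m + 2 + 1), (x : ℝ) * (x - 1) * betaBinPmf (m + 2) α β x
      = ((m : ℝ) + 2) * (m + 1) * (α * (α + 1)) / ((α + β) * (α + β + 1)) := by
  have hA := (Real.Gamma_pos_of_pos hα).ne'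
  have hB := (Real.Gamma_pos_of_pos hβ).ne'
  have hAB : Real.Gamma (α + β) ≠ 0 := (Real.Gamma_pos_of_pos (by positivity)).ne'
  have hN : Real.Gamma ((m : ℝ) + 2 + α + β) ≠ 0 := (Real.Gamma_pos_of_pos (by positivity)).ne'
  have h' : α + β ≠ 0 := by positivity
  have h'' : α + β + 1 ≠ 0 := by positivity
  rw [Finset.sum_range_succ', Finset.sum_range_succ']
  have hs := bb_sum m (α + 2) β (by positivity) hβ
  have e : ∀ y ∈ range (m + 1), (((y + 1 + 1 : ℕ) : ℝ)) * (((y + 1 + 1 : ℕ) : ℝ) - 1) *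
      betaBinPmf (m + 2) α β (y + 1 + 1) =
      (((m : ℝ) + 2) * (m + 1) / (Real.Gamma ((m : ℝ) + 2 + α + β) *
        (Real.Gamma α * Real.Gamma β / Real.Gamma (α + β)))) *
      ((m.choose y : ℝ) * (Real.Gamma (y + (α + 2)) * Real.Gamma ((m : ℝ) - y + β))) := by
    intro y _
    have hc := choose_two m y
    unfold betaBinPmf
    have a1 : (((y + 1 + 1 : ℕ) : ℝ)) + α = y + (α + 2) := by push_cast; ring
    have a2 : (((m + 2 : ℕ) : ℝ)) - ((y + 1 + 1 : ℕ) : ℝ) + β = (m : ℝ) - y + β := by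
      push_cast; ring
    rw [a1, a2]
    push_cast
    field_simp
    linear_combination (Real.Gamma ((m : ℝ) - y + β)) * hc
  rw [Finset.sum_congr rfl e, ← Finset.mul_sum, hs]
  have b1 : (m : ℝ) + (α + 2) + β = m + 2 + α + β := by ring
  have b2 : α + 2 + β = α + β + 1 + 1 := by ring
  have b3 : α + 2 = α + 1 + 1 := by ring
  rw [b1, b2, b3, Real.Gamma_add_one (by positivity : α + 1 ≠ 0), Real.Gamma_add_one hα.ne',
    Real.Gamma_add_one h'', Real.Gamma_add_one h']
  push_cast
  field_simp
  ring

theorem bb_nonneg (n : ℕ) (α β : ℝ) (hα : 0 < α) (hβ : 0 < β) (x : ℕ) (hx : x ≤ n) :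
    0 ≤ betaBinPmf n α β x := by
  have hx' : (0 : ℝ) ≤ (n : ℝ) - x := sub_nonneg.2 (by exact_mod_cast hx)
  have h1 := Real.Gamma_pos_of_pos hα
  have h2 := Real.Gamma_pos_of_pos hβ
  have h3 : 0 < Real.Gamma (α + β) := Real.Gamma_pos_of_pos (by positivity)
  have h4 : 0 < Real.Gamma (x + α) := Real.Gamma_pos_of_pos (by positivity)
  have h5 : 0 < Real.Gamma ((n : ℝ) - x + β) := Real.Gamma_pos_of_pos (by positivity)
  have h6 : 0 < Real.Gamma ((n : ℝ) + α + β) := Real.Gamma_pos_of_pos (by positivity)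
  unfold betaBinPmf
  positivity

/-- Fix `r > 0`, `ε ∈ (0,1)`.  For each `k ≥ 1`, `n ≥ 1`, let `N₁` given `K = k,
N = n` be `BetaBinomial(n, r, (k-1)r)`.  Then there exists a sequence
`c₁, c₂, … ≥ 0`, not depending on `n`, with `c_k → 0` as `k → ∞`, such that
`k · P(N₁/n ≥ ε | K = k, N = n) ≤ c_k` for all `n ≥ 2/ε` and all `k ≥ 1`. -/
theorem bounding_sequence_exists (r ε : ℝ) (hr : 0 < r) (hε0 : 0 < ε) (hε1 : ε < 1) :
    ∃ c : ℕ → ℝ, (∀ k, 0 ≤ c k) ∧ Tendsto c atTop (nhds 0) ∧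
      ∀ k : ℕ, 1 ≤ k → ∀ n : ℕ, 2 / ε ≤ (n : ℝ) →
        (k : ℝ) * (∑ x ∈ Finset.range (n + 1),
            if ε ≤ (x : ℝ) / n then betaBinPmf n r (((k : ℝ) - 1) * r) x else 0)
          ≤ c k := by
  refine ⟨fun k => (2 * (r + 1) / ε ^ 2) / ((k : ℝ) * r + 1), fun k => by positivity, ?_, ?_⟩
  · refine Tendsto.div_atTop tendsto_const_nhds ?_
    exact tendsto_atTop_add_const_right _ _
      (tendsto_natCast_atTop_atTop.atTop_mul_const hr)
  intro k hk n hn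
  rcases Nat.eq_or_lt_of_le hk with rfl | hk2
  · have : ∀ x, betaBinPmf n r (((1 : ℕ) - 1 : ℝ) * r) x = 0 := by
      intro x; simp [betaBinPmf, Real.Gamma_zero]
    simp only [this, ite_self, Finset.sum_const_zero, mul_zero]
    positivity
  have hεn : 2 ≤ ε * n := by
    rw [div_le_iff₀ hε0] at hn; linarith
  have hn2 : (2 : ℝ) < n := by
    have : (0 : ℝ) ≤ n := Nat.cast_nonneg n
    by_contra h
    push Not at h
    nlinarith
  obtain ⟨m, rfl⟩ : ∃ m, n = m + 2 := by
    have : 2 < n := by exact_mod_cast hn2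
    exact ⟨n - 2, by omega⟩
  have hk2' : (1 : ℝ) < k := by exact_mod_cast hk2
  have hβ : 0 < ((k : ℝ) - 1) * r := mul_pos (by linarith) hr
  have hm := bb_moment m r _ hr hβ
  set β := ((k : ℝ) - 1) * r with hβd
  have hkr : r + β = k * r := by rw [hβd]; ring
  rw [hkr] at hm
  set N : ℝ := ((m + 2 : ℕ) : ℝ) with hN
  have hmN : (m : ℝ) = N - 2 := by rw [hN]; push_cast; ring
  have hN0 : 0 < N := by linarith
  have hle : ∑ x ∈ Finset.range (m + 2 + 1),
      (if ε ≤ (x : ℝ) / N then betaBinPmf (m + 2) r β x else 0) ≤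
      ∑ x ∈ Finset.range (m + 2 + 1),
        (2 / (ε * N) ^ 2) * ((x : ℝ) * (x - 1) * betaBinPmf (m + 2) r β x) := by
    refine Finset.sum_le_sum fun x hx => ?_
    have hx' : x ≤ m + 2 := by simpa [Nat.lt_succ_iff] using hx
    have hp := bb_nonneg (m + 2) r β hr hβ x hx'
    have hxx : (0 : ℝ) ≤ (x : ℝ) * (x - 1) := by
      rcases Nat.eq_zero_or_pos x with rfl | h
      · simp
      · have : (1 : ℝ) ≤ x := by exact_mod_cast h
        exact mul_nonneg (by linarith) (by linarith)
    split_ifs with h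
    · rw [le_div_iff₀ hN0] at h
      have h1 : 1 ≤ 2 / (ε * N) ^ 2 * ((x : ℝ) * (x - 1)) := by
        rw [div_mul_eq_mul_div, le_div_iff₀ (by positivity)]
        nlinarith
      calc betaBinPmf (m + 2) r β x = 1 * betaBinPmf (m + 2) r β x := (one_mul _).symm
        _ ≤ (2 / (ε * N) ^ 2 * ((x : ℝ) * (x - 1))) * betaBinPmf (m + 2) r β x :=
          mul_le_mul_of_nonneg_right h1 hp
        _ = _ := by ring
    · positivity
  rw [← Finset.mul_sum, hm, hmN] at hle
  have hk0 : (0 : ℝ) < k := by linarith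
  calc _ ≤ (k : ℝ) * _ := mul_le_mul_of_nonneg_left hle hk0.le
    _ = (2 * (r + 1) / ε ^ 2) / ((k : ℝ) * r + 1) * ((N - 1) / N) := by
      field_simp
      ring
    _ ≤ (2 * (r + 1) / ε ^ 2) / ((k : ℝ) * r + 1) * 1 := by
      refine mul_le_mul_of_nonneg_left ?_ (by positivity)
      rw [div_le_one hN0]; linarith
    _ = _ := mul_one _
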